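/- Let α ∈ (0,1) and let h ∈ C^{0,α}(ℝ²) (bounded and α-Hölder continuous). Then the convolution K_α ⋆ h is log-Lipschitz continuous: there exists a constant C > 0, independent of x and x̃, such that for all x, x̃ ∈ ℝ², |(K_α ⋆ h)(x) − (K_α ⋆ h)(x̃)| ≤ C ‖h‖_{C^{0,α}} |x − x̃| (1 − log⁻|x − x̃|), where log⁻ r = min(log r, 0). -/

import Mathlib

open MeasureTheory Real Set Filter
open scoped RealInnerProductSpace FourierTransform Topology

noncomputable section

/-- The plane `ℝ²` with the Euclidean norm. -/
abbrev R2 := EuclideanSpace ℝ (Fin 2)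

/-- The point `(a, b)` of `ℝ²`. -/
def mk2 (a b : ℝ) : R2 := (EuclideanSpace.equiv (Fin 2) ℝ).symm ![a, b]

/-- The perpendicular vector: `(z₁, z₂)^⊥ = (z₂, -z₁)`. -/
def perp (z : R2) : R2 := mk2 (z 1) (-(z 0))

/-- The `α`-SQG kernel `K_α(z) = z^⊥ / |z|^{2+α}`. -/
def Kal (α : ℝ) (z : R2) : R2 := ‖z‖ ^ (-(2 + α)) • perp z

/-- The `α`-SQG velocity `u = K_α ⋆ θ`, `u(x) = ∫ (x-y)^⊥/|x-y|^{2+α} θ(y) dy`. -/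
def vel (α : ℝ) (θ : R2 → ℝ) (x : R2) : R2 := ∫ y, θ y • Kal α (x - y)

/-- Sup norm `‖h‖_{L^∞}` (as a supremum). -/
def supNorm (h : R2 → ℝ) : ℝ := ⨆ x, |h x|

/-- Hölder seminorm of exponent `γ`: `sup_{x ≠ y} |h x - h y| / ‖x - y‖^γ`. -/
def holderSemi (γ : ℝ) (h : R2 → ℝ) : ℝ :=
  ⨆ p : {q : R2 × R2 // q.1 ≠ q.2}, |h p.1.1 - h p.1.2| / ‖p.1.1 - p.1.2‖ ^ γ

/-- The Hölder norm `‖h‖_{C^{0,γ}} = ‖h‖_{L^∞} + [h]_{C^{0,γ}}`. -/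
def holderNorm (γ : ℝ) (h : R2 → ℝ) : ℝ := supNorm h + holderSemi γ h

/-- Membership in `C^{0,γ}(ℝ²)`: continuous, bounded, with finite Hölder seminorm. -/
def IsHolder (γ : ℝ) (h : R2 → ℝ) : Prop :=
  Continuous h ∧ ∃ C : ℝ, (∀ x, |h x| ≤ C) ∧ ∀ x y, |h x - h y| ≤ C * ‖x - y‖ ^ γ


lemma norm_perp (z : R2) : ‖perp z‖ = ‖z‖ := by
  simp [perp, mk2, EuclideanSpace.norm_eq, Fin.sum_univ_two, add_comm]

lemma perp_sub (z w : R2) : perp (z - w) = perp z - perp w := by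
  ext i; fin_cases i <;> simp [perp, mk2] <;> ring

lemma perp_smul (c : ℝ) (z : R2) : perp (c • z) = c • perp z := by
  ext i; fin_cases i <;> simp [perp, mk2]

lemma Kal_smul (α : ℝ) (c : ℝ) (hc : 0 < c) (z : R2) :
    Kal α (c • z) = c ^ (-(1 + α)) • Kal α z := by
  unfold Kal
  rw [perp_smul, norm_smul, Real.norm_of_nonneg hc.le, Real.mul_rpow hc.le (norm_nonneg _),
    smul_smul, smul_smul]
  congr 1
  have : c ^ (-(1 + α)) = c ^ (-(2 + α)) * c := by
    rw [← Real.rpow_add_one hc.ne']; congr 1; ring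
  rw [this]; ring

lemma norm_Kal_le (α : ℝ) (z : R2) : ‖Kal α z‖ ≤ ‖z‖ ^ (-(1 + α)) := by
  unfold Kal
  rw [norm_smul, norm_perp, Real.norm_of_nonneg (by positivity)]
  rcases eq_or_ne z 0 with rfl | hz
  · simp; positivity
  · rw [← Real.rpow_add_one (norm_ne_zero_iff.2 hz)]; apply le_of_eq; congr 1; ring

lemma measurable_Kal (α : ℝ) : Measurable (Kal α) := by
  have hp : Continuous perp := by
    unfold perp mk2
    refine (EuclideanSpace.equiv (Fin 2) ℝ).symm.continuous.comp ?_
    refine continuous_pi fun i => ?_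
    fin_cases i <;> simp <;> fun_prop
  unfold Kal
  exact (measurable_norm.pow_const _).smul hp.measurable

lemma rpow_neg_diff (s m a b : ℝ) (hs : 0 < s) (hm : 0 < m) (ha : m ≤ a) (hb : m ≤ b) :
    |a ^ (-s) - b ^ (-s)| ≤ s * m ^ (-s - 1) * |a - b| := by
  have := Convex.norm_image_sub_le_of_norm_hasDerivWithin_le (f := fun x : ℝ => x ^ (-s))
    (f' := fun x => -s * x ^ (-s - 1)) (s := Ici m) (C := s * m ^ (-s - 1)) (x := b) (y := a)
    (fun x hx => (Real.hasDerivAt_rpow_const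
      (Or.inl (lt_of_lt_of_le hm hx).ne')).hasDerivWithinAt) ?_ (convex_Ici m) hb ha
  · simpa using this
  · intro x hx
    have hx0 : 0 < x := lt_of_lt_of_le hm hx
    rw [norm_mul, norm_neg, Real.norm_of_nonneg hs.le, Real.norm_of_nonneg (by positivity)]
    gcongr ?_ * ?_
    exact Real.rpow_le_rpow_of_nonpos hm hx (by linarith)

/-- constant in the far-field bound -/
def farC (α : ℝ) : ℝ := 1 + (2 + α) * 2 ^ (3 + α) * 2

lemma Kal_far (α : ℝ) (hα : 0 < α) (y e : R2) (hy : 2 * ‖e‖ ≤ ‖y‖) (hy0 : y ≠ 0) :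
    ‖Kal α y - Kal α (y - e)‖ ≤ farC α * ‖e‖ * ‖y‖ ^ (-(2 + α)) := by
  have hy1 : 0 < ‖y‖ := norm_pos_iff.2 hy0
  have key : Kal α y - Kal α (y - e) = ‖y‖ ^ (-(2 + α)) • perp e
      + (‖y‖ ^ (-(2 + α)) - ‖y - e‖ ^ (-(2 + α))) • perp (y - e) := by
    simp only [Kal, perp_sub]; module
  have h1 : ‖y‖ / 2 ≤ ‖y - e‖ := by have := norm_sub_norm_le y e; linarith
  have h2 : ‖y - e‖ ≤ 2 * ‖y‖ := by have := norm_sub_le y e; linarith [norm_nonneg e]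
  have h3 := rpow_neg_diff (2 + α) (‖y‖ / 2) ‖y‖ ‖y - e‖ (by linarith) (by linarith)
    (by linarith) h1
  have h4 : |‖y‖ - ‖y - e‖| ≤ ‖e‖ := by
    have := abs_norm_sub_norm_le y (y - e); simpa using this
  have h5 : (‖y‖ / 2) ^ (-(2 + α) - 1) * ‖y‖ = 2 ^ (3 + α) * ‖y‖ ^ (-(2 + α)) := by
    rw [Real.div_rpow hy1.le (by norm_num), Real.rpow_sub_one hy1.ne',
      show -(2 + α) - 1 = -(3 + α) by ring, Real.rpow_neg (by norm_num : (0:ℝ) ≤ 2) (3 + α)]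
    field_simp
  rw [key]
  refine (norm_add_le _ _).trans ?_
  rw [norm_smul, norm_smul, norm_perp, norm_perp, Real.norm_of_nonneg (by positivity),
    Real.norm_eq_abs]
  calc _ ≤ ‖y‖ ^ (-(2 + α)) * ‖e‖
        + ((2 + α) * (‖y‖ / 2) ^ (-(2 + α) - 1) * ‖e‖) * (2 * ‖y‖) := by
        gcongr
        exact h3.trans (by gcongr)
    _ = ‖y‖ ^ (-(2 + α)) * ‖e‖
        + 2 * (2 + α) * ‖e‖ * ((‖y‖ / 2) ^ (-(2 + α) - 1) * ‖y‖) := by ring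
    _ = _ := by rw [h5, farC]; ring

/-- area constant -/
def areaC : ℝ := 2 * volume.real (Metric.ball (0 : R2) 1)

/-- near profile -/
def nearP (α R : ℝ) : ℝ → ℝ := (Iio R).indicator fun r => r ^ (-(1 + α))
/-- far profile -/
def farP (p R : ℝ) : ℝ → ℝ := (Ici R).indicator fun r => r ^ (-(2 + p))

lemma near_aux (α R : ℝ) : EqOn (fun r : ℝ => r ^ (Module.finrank ℝ R2 - 1) • nearP α R r)
    ((Iio R).indicator fun r => r ^ (-α)) (Ioi 0) := by
  intro r (hr : 0 < r)
  by_cases h : r < R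
  · simp only [nearP, finrank_euclideanSpace, Fintype.card_fin, smul_eq_mul,
      indicator_of_mem (show r ∈ Iio R from h)]
    rw [show 2 - 1 = 1 from rfl, pow_one, mul_comm, ← Real.rpow_add_one hr.ne']; congr 1; ring
  · simp [nearP, h]

lemma far_aux (p R : ℝ) : EqOn (fun r : ℝ => r ^ (Module.finrank ℝ R2 - 1) • farP p R r)
    ((Ici R).indicator fun r => r ^ (-1 - p)) (Ioi 0) := by
  intro r (hr : 0 < r)
  by_cases h : R ≤ r
  · simp only [farP, finrank_euclideanSpace, Fintype.card_fin, smul_eq_mul,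
      indicator_of_mem (show r ∈ Ici R from h)]
    rw [show 2 - 1 = 1 from rfl, pow_one, mul_comm, ← Real.rpow_add_one hr.ne']; congr 1; ring
  · simp [farP, h]

lemma near_int (α R : ℝ) (hα : α < 1) (hR : 0 < R) :
    Integrable (fun y : R2 => nearP α R ‖y‖) := by
  rw [integrable_fun_norm_addHaar, integrableOn_congr_fun (near_aux α R) measurableSet_Ioi]
  rw [IntegrableOn, integrable_indicator_iff measurableSet_Iio, IntegrableOn,
    Measure.restrict_restrict measurableSet_Iio, inter_comm, Ioi_inter_Iio]
  exact (intervalIntegral.integrableOn_Ioo_rpow_iff hR).2 (by linarith)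

lemma near_val (α R : ℝ) (hα : α < 1) (hR : 0 < R) :
    ∫ y : R2, nearP α R ‖y‖ = areaC * (R ^ (1 - α) / (1 - α)) := by
  rw [integral_fun_norm_addHaar, setIntegral_congr_fun measurableSet_Ioi (near_aux α R),
    setIntegral_indicator measurableSet_Iio, Ioi_inter_Iio, ← integral_Ioc_eq_integral_Ioo,
    ← intervalIntegral.integral_of_le hR.le, integral_rpow (Or.inl (by linarith))]
  rw [Real.zero_rpow (by linarith)]
  simp [areaC, mul_assoc]
  rw [show -α + 1 = 1 - α by ring]
  exact Or.inl rfl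

lemma far_int (p R : ℝ) (hp : 0 < p) (hR : 0 < R) :
    Integrable (fun y : R2 => farP p R ‖y‖) := by
  rw [integrable_fun_norm_addHaar, integrableOn_congr_fun (far_aux p R) measurableSet_Ioi]
  rw [IntegrableOn, integrable_indicator_iff measurableSet_Ici, IntegrableOn,
    Measure.restrict_restrict measurableSet_Ici,
    inter_eq_left.2 (show Ici R ⊆ Ioi 0 from fun r hr => lt_of_lt_of_le hR hr)]
  exact (integrableOn_Ici_iff_integrableOn_Ioi (by simp)).2 (integrableOn_Ioi_rpow_of_lt (by linarith) hR)

lemma far_val (p R : ℝ) (hp : 0 < p) (hR : 0 < R) :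
    ∫ y : R2, farP p R ‖y‖ = areaC * (R ^ (-p) / p) := by
  rw [integral_fun_norm_addHaar, setIntegral_congr_fun measurableSet_Ioi (far_aux p R),
    setIntegral_indicator measurableSet_Ici, inter_comm (Ioi 0) (Ici R),
    inter_eq_left.2 (show Ici R ⊆ Ioi 0 from fun r hr => lt_of_lt_of_le hR hr),
    integral_Ici_eq_integral_Ioi, integral_Ioi_rpow_of_lt (by linarith) hR]
  simp [areaC, mul_assoc]
  rw [show -1 - p + 1 = - p by ring, neg_div_neg_eq]
  exact Or.inl rfl

/-- dominating function -/
def dom (α β : ℝ) (e y : R2) : ℝ :=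
  (2 * ‖e‖) ^ β * (nearP α (3 * ‖e‖) ‖y‖ + nearP α (3 * ‖e‖) ‖y - e‖)
    + farC α * ‖e‖ * farP (α - β) (2 * ‖e‖) ‖y‖

lemma dom_bound (α β : ℝ) (hα : 0 < α) (hβ : 0 ≤ β) (e y : R2) (he : e ≠ 0) :
    ‖y‖ ^ β * ‖Kal α y - Kal α (y - e)‖ ≤ dom α β e y := by
  have he' : 0 < ‖e‖ := norm_pos_iff.2 he
  have hfc : 0 ≤ farC α := by unfold farC; positivity
  unfold dom
  by_cases h : ‖y‖ < 2 * ‖e‖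
  · have h1 : ‖y‖ ∈ Iio (3 * ‖e‖) := by simp only [mem_Iio]; linarith
    have h2 : ‖y - e‖ ∈ Iio (3 * ‖e‖) := by
      simp only [mem_Iio]; linarith [norm_sub_le y e]
    have h3 : ‖y‖ ∉ Ici (2 * ‖e‖) := by simpa using h
    simp only [nearP, farP, indicator_of_mem h1, indicator_of_mem h2, indicator_of_notMem h3,
      mul_zero, add_zero]
    gcongr
    exact (norm_sub_le _ _).trans (add_le_add (norm_Kal_le _ _) (norm_Kal_le _ _))
  · push Not at h
    have hy : 0 < ‖y‖ := by linarith
    have h3 : ‖y‖ ∈ Ici (2 * ‖e‖) := h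
    have hn : ∀ r, 0 ≤ r → 0 ≤ nearP α (3 * ‖e‖) r := fun r hr => by
      unfold nearP indicator; split_ifs <;> positivity
    have := hn _ (norm_nonneg y)
    have := hn _ (norm_nonneg (y - e))
    have h5 := Kal_far α hα y e h (norm_pos_iff.1 hy)
    have h6 : ‖y‖ ^ β * ‖Kal α y - Kal α (y - e)‖
        ≤ farC α * ‖e‖ * farP (α - β) (2 * ‖e‖) ‖y‖ := by
      simp only [farP, indicator_of_mem h3]
      calc _ ≤ ‖y‖ ^ β * (farC α * ‖e‖ * ‖y‖ ^ (-(2 + α))) := by gcongr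
        _ = farC α * ‖e‖ * (‖y‖ ^ β * ‖y‖ ^ (-(2 + α))) := by ring
        _ = _ := by rw [← Real.rpow_add hy]; congr 2; ring
    have : 0 ≤ (2 * ‖e‖) ^ β * (nearP α (3 * ‖e‖) ‖y‖ + nearP α (3 * ‖e‖) ‖y - e‖) := by
      positivity
    linarith

lemma dom_int (α β : ℝ) (hα : α < 1) (hβ : β < α) (e : R2) (he : e ≠ 0) :
    Integrable (dom α β e) := by
  have he' : 0 < ‖e‖ := norm_pos_iff.2 he
  have h1 := near_int α (3 * ‖e‖) hα (by positivity)
  exact ((h1.add (h1.comp_sub_right e)).const_mul _).add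
    ((far_int (α - β) (2 * ‖e‖) (by linarith) (by positivity)).const_mul _)

lemma dom_val (α β : ℝ) (hα : α < 1) (hβ : β < α) (e : R2) (he : e ≠ 0) :
    ∫ y, dom α β e y = (2 * ‖e‖) ^ β * (2 * (areaC * ((3 * ‖e‖) ^ (1 - α) / (1 - α))))
      + farC α * ‖e‖ * (areaC * ((2 * ‖e‖) ^ (-(α - β)) / (α - β))) := by
  have he' : 0 < ‖e‖ := norm_pos_iff.2 he
  have h1 := near_int α (3 * ‖e‖) hα (by positivity)
  have h2 := h1.comp_sub_right e
  have h3 := far_int (α - β) (2 * ‖e‖) (by linarith) (by positivity)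
  have h12 : Integrable (fun y : R2 => nearP α (3 * ‖e‖) ‖y‖ + nearP α (3 * ‖e‖) ‖y - e‖) :=
    h1.add h2
  unfold dom
  rw [integral_add (h12.const_mul _) (h3.const_mul _), integral_const_mul,
    integral_const_mul, integral_add h1 h2,
    integral_sub_right_eq_self (fun y : R2 => nearP α (3 * ‖e‖) ‖y‖) e,
    near_val _ _ hα (by positivity), far_val _ _ (by linarith) (by positivity)]
  ring

lemma Kdiff_int (α : ℝ) (hα : α ∈ Ioo (0:ℝ) 1) (e : R2) :
    Integrable (fun y => Kal α y - Kal α (y - e)) := by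
  rcases eq_or_ne e 0 with rfl | he
  · simp
  · refine (dom_int α 0 hα.2 hα.1 e he).mono' ?_ (.of_forall fun y => ?_)
    · exact ((measurable_Kal α).sub
        ((measurable_Kal α).comp (measurable_id.sub_const e))).aestronglyMeasurable
    · simpa using dom_bound α 0 hα.1 le_rfl e y he

lemma Kdiff_zero (α : ℝ) (hα : α ∈ Ioo (0:ℝ) 1) (e : R2) :
    ∫ y, (Kal α y - Kal α (y - e)) = 0 := by
  set F := ∫ y, (Kal α y - Kal α (y - e)) with hF
  have hi := Kdiff_int α hα e
  have h1 : ∫ y, (Kal α y - Kal α (y - (2:ℝ) • e)) = F + F := by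
    conv_rhs => rw [hF]
    nth_rewrite 2 [← integral_sub_right_eq_self (fun y => Kal α y - Kal α (y - e)) e]
    rw [← integral_add hi (hi.comp_sub_right e)]
    congr 1; ext1 y
    rw [show y - (2:ℝ) • e = y - e - e by module]; abel
  have h2 := Measure.integral_comp_smul (volume : Measure R2)
    (fun y => Kal α y - Kal α (y - (2:ℝ) • e)) 2
  simp only [← smul_sub, Kal_smul α 2 two_pos] at h2
  rw [integral_smul, ← hF, h1, finrank_euclideanSpace, Fintype.card_fin] at h2
  have h3 : ((2:ℝ) ^ (-(1 + α)) - 1 / 2) • F = 0 := by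
    rw [sub_smul, h2, ← two_smul ℝ F, smul_smul, ← sub_smul]
    norm_num [abs_of_pos]
  rcases smul_eq_zero.1 h3 with h | h
  · exfalso
    have : (2:ℝ) ^ (-(1 + α)) < 2 ^ (-1 : ℝ) :=
      Real.rpow_lt_rpow_of_exponent_lt (by norm_num) (by linarith [hα.1])
    rw [Real.rpow_neg_one] at this
    linarith
  · exact h

lemma le_supNorm (γ : ℝ) (h : R2 → ℝ) (hh : IsHolder γ h) (x : R2) : |h x| ≤ supNorm h := by
  obtain ⟨_, C, hC, _⟩ := hh
  exact le_ciSup (f := fun x => |h x|) ⟨C, by rintro _ ⟨x, rfl⟩; exact hC x⟩ x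

lemma le_holderSemi (γ : ℝ) (h : R2 → ℝ) (hh : IsHolder γ h) (x y : R2) (hxy : x ≠ y) :
    |h x - h y| ≤ holderSemi γ h * ‖x - y‖ ^ γ := by
  obtain ⟨_, C, _, hC⟩ := hh
  have hpos : ∀ x y : R2, x ≠ y → 0 < ‖x - y‖ ^ γ := fun x y hxy =>
    Real.rpow_pos_of_pos (norm_pos_iff.2 (sub_ne_zero.2 hxy)) _
  rw [← div_le_iff₀ (hpos x y hxy)]
  refine le_ciSup (f := fun p : {q : R2 × R2 // q.1 ≠ q.2} =>
    |h p.1.1 - h p.1.2| / ‖p.1.1 - p.1.2‖ ^ γ) ⟨C, ?_⟩ ⟨(x, y), hxy⟩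
  rintro _ ⟨⟨⟨a, b⟩, hab⟩, rfl⟩
  exact (div_le_iff₀ (hpos a b hab)).2 (hC a b)

lemma holder_diff (α β : ℝ) (hβ : 0 ≤ β) (hβα : β ≤ α) (h : R2 → ℝ) (hh : IsHolder α h)
    (x y : R2) : |h (x - y) - h x| ≤ 2 * holderNorm α h * ‖y‖ ^ β := by
  have hS : 0 ≤ supNorm h := (abs_nonneg _).trans (le_supNorm α h hh 0)
  have hH : 0 ≤ holderSemi α h := Real.iSup_nonneg fun p => by positivity
  have hN : 0 ≤ holderNorm α h := add_nonneg hS hH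
  rcases eq_or_ne y 0 with rfl | hy
  · simp only [sub_zero, sub_self, abs_zero]; positivity
  have hy' : 0 < ‖y‖ := norm_pos_iff.2 hy
  rcases le_total ‖y‖ 1 with h1 | h1
  · have := le_holderSemi α h hh (x - y) x (by simpa using hy)
    rw [show x - y - x = -y by abel, norm_neg] at this
    refine this.trans ?_
    gcongr ?_ * ?_
    · unfold holderNorm; linarith
    · exact Real.rpow_le_rpow_of_exponent_ge hy' h1 hβα
  · have h2 : 1 ≤ ‖y‖ ^ β := Real.one_le_rpow h1 hβ
    calc |h (x - y) - h x| ≤ |h (x - y)| + |h x| := abs_sub _ _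
      _ ≤ 2 * supNorm h := by linarith [le_supNorm α h hh (x - y), le_supNorm α h hh x]
      _ ≤ 2 * holderNorm α h * 1 := by unfold holderNorm; linarith
      _ ≤ _ := by gcongr

lemma main_bound (α β : ℝ) (hα : α ∈ Ioo (0:ℝ) 1) (hβ : 0 ≤ β) (hβα : β < α)
    (h : R2 → ℝ) (hh : IsHolder α h) (x xt : R2) (hx : x ≠ xt) :
    ‖∫ y, h y • (Kal α (x - y) - Kal α (xt - y))‖ ≤
      2 * holderNorm α h * ∫ y, dom α β (x - xt) y := by
  have he : x - xt ≠ 0 := sub_ne_zero.2 hx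
  have hN : 0 ≤ holderNorm α h :=
    add_nonneg ((abs_nonneg _).trans (le_supNorm α h hh 0)) (Real.iSup_nonneg fun p => by positivity)
  set e := x - xt with hedef
  have hi := Kdiff_int α hα e
  have e1 : ∫ y, h y • (Kal α (x - y) - Kal α (xt - y))
      = ∫ y, h (x - y) • (Kal α y - Kal α (y - e)) := by
    rw [← integral_sub_left_eq_self _ volume x]
    congr 1; ext1 y
    rw [sub_sub_cancel, show xt - (x - y) = y - e by rw [hedef]; abel]
  have hi2 : Integrable (fun y => h (x - y) • (Kal α y - Kal α (y - e))) := by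
    exact hi.bdd_smul (C := supNorm h)
      (hh.1.comp (continuous_const.sub continuous_id)).aestronglyMeasurable
      (Eventually.of_forall fun y => le_supNorm α h hh (x - y))
  have e2 : ∫ y, h (x - y) • (Kal α y - Kal α (y - e))
      = ∫ y, (h (x - y) - h x) • (Kal α y - Kal α (y - e)) := by
    simp only [sub_smul (h _) (h x)]
    have hi3 : Integrable (fun y => h x • (Kal α y - Kal α (y - e))) := hi.smul (h x)
    rw [integral_sub hi2 hi3, integral_smul, Kdiff_zero α hα e, smul_zero, sub_zero]
  rw [e1, e2, ← integral_const_mul]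
  refine norm_integral_le_of_norm_le ((dom_int α β hα.2 hβα e he).const_mul _)
    (.of_forall fun y => ?_)
  rw [norm_smul, Real.norm_eq_abs]
  calc _ ≤ (2 * holderNorm α h * ‖y‖ ^ β) * ‖Kal α y - Kal α (y - e)‖ := by
        gcongr; exact holder_diff α β hβ hβα.le h hh x y
    _ = 2 * holderNorm α h * (‖y‖ ^ β * ‖Kal α y - Kal α (y - e)‖) := by ring
    _ ≤ _ := by gcongr; exact dom_bound α β hα.1 hβ e y he

/-- **Log-Lipschitz continuity of the velocity (Lemma 2.1).**  For `h ∈ C^{0,α}(ℝ²)`,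
`|(K_α ⋆ h)(x) - (K_α ⋆ h)(x̃)| ≤ C ‖h‖_{C^{0,α}} |x-x̃| (1 - log⁻ |x-x̃|)`,
with `C` independent of `x, x̃` (and of `h`). -/
theorem logLipschitz_velocity (α : ℝ) (hα : α ∈ Set.Ioo (0:ℝ) 1) :
    ∃ C > 0, ∀ h : R2 → ℝ, IsHolder α h → ∀ x xt : R2,
      ‖∫ y, h y • (Kal α (x - y) - Kal α (xt - y))‖ ≤
        C * holderNorm α h * ‖x - xt‖ * (1 - min (Real.log ‖x - xt‖) 0) := by
  obtain ⟨h0, h1⟩ := hα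
  have h1' : 0 < 1 - α := by linarith
  have hA : 0 ≤ areaC := by unfold areaC; positivity
  have hfc : 0 < farC α := by unfold farC; positivity
  set E := Real.exp 1 with hE
  have hE0 : 0 < E := Real.exp_pos 1
  set C0 := 12 * areaC * E / (1 - α) + farC α * areaC * E / α with hC0
  have hC0' : 0 ≤ C0 := by positivity
  refine ⟨2 * C0 + 1, by positivity, fun h hh x xt => ?_⟩
  have hN : 0 ≤ holderNorm α h :=
    add_nonneg ((abs_nonneg _).trans (le_supNorm α h hh 0)) (Real.iSup_nonneg fun p => by positivity)
  rcases eq_or_ne x xt with rfl | hx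
  · simp
  have hd : 0 < ‖x - xt‖ := norm_pos_iff.2 (sub_ne_zero.2 hx)
  set d := ‖x - xt‖ with hdd
  set L := 1 - min (Real.log d) 0 with hL
  have hL1 : 1 ≤ L := by have := min_le_right (Real.log d) 0; linarith
  have hL0 : 0 < L := by linarith
  have hLd : -Real.log d ≤ L := by have := min_le_left (Real.log d) 0; linarith
  set δ := α / L with hδ
  have hδ0 : 0 < δ := by positivity
  have hδα : δ ≤ α := div_le_self h0.le hL1
  have hm := main_bound α (α - δ) ⟨h0, h1⟩ (by linarith) (by linarith) h hh x xt hx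
  rw [dom_val α (α - δ) h1 (by linarith) _ (sub_ne_zero.2 hx), ← hdd] at hm
  have hdδ : d ^ (-δ) ≤ E := by
    rw [Real.rpow_def_of_pos hd, hE]
    apply Real.exp_le_exp.2
    have : Real.log d * -δ = α * (-Real.log d / L) := by rw [hδ]; ring
    rw [this]
    have h3 : -Real.log d / L ≤ 1 := (div_le_one hL0).2 hLd
    nlinarith
  have t1 : (2 * d) ^ (α - δ) * (3 * d) ^ (1 - α) ≤ 6 * (d * E) := by
    rw [Real.mul_rpow (by norm_num) hd.le, Real.mul_rpow (by norm_num) hd.le]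
    have a1 : (2:ℝ) ^ (α - δ) ≤ 2 := by
      simpa using Real.rpow_le_rpow_of_exponent_le (x := 2) (by norm_num)
        (show α - δ ≤ 1 by linarith)
    have a2 : (3:ℝ) ^ (1 - α) ≤ 3 := by
      simpa using Real.rpow_le_rpow_of_exponent_le (x := 3) (by norm_num)
        (show 1 - α ≤ 1 by linarith)
    have a3 : d ^ (α - δ) * d ^ (1 - α) = d * d ^ (-δ) := by
      rw [← Real.rpow_add hd, mul_comm, ← Real.rpow_add_one hd.ne']; congr 1; ring
    calc _ = 2 ^ (α - δ) * 3 ^ (1 - α) * (d ^ (α - δ) * d ^ (1 - α)) := by ring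
      _ ≤ (2 * 3) * (d * E) := by rw [a3]; gcongr
      _ = _ := by ring
  have t2 : (2 * d) ^ (-δ) ≤ E := by
    refine le_trans ?_ hdδ
    exact Real.rpow_le_rpow_of_nonpos hd (by linarith) (by linarith)
  refine hm.trans ?_
  rw [sub_sub_cancel]
  have t3 : (2 * d) ^ (α - δ) * (2 * (areaC * ((3 * d) ^ (1 - α) / (1 - α))))
      + farC α * d * (areaC * ((2 * d) ^ (-δ) / δ)) ≤ C0 * d * L := by
    calc _ = 2 * areaC / (1 - α) * ((2 * d) ^ (α - δ) * (3 * d) ^ (1 - α))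
          + farC α * d * areaC * (2 * d) ^ (-δ) * (L / α) := by
          rw [hδ]; field_simp
      _ ≤ 2 * areaC / (1 - α) * (6 * (d * E)) * L + farC α * d * areaC * E * (L / α) := by
          have : 2 * areaC / (1 - α) * (6 * (d * E)) ≤ 2 * areaC / (1 - α) * (6 * (d * E)) * L :=
            le_mul_of_one_le_right (by positivity) hL1
          refine add_le_add (le_trans ?_ this) ?_ <;> gcongr
      _ = _ := by rw [hC0]; ring
  calc _ ≤ 2 * holderNorm α h * (C0 * d * L) := by gcongr
    _ ≤ _ := by
      have : 0 ≤ holderNorm α h * d * L := by positivity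
      nlinarith
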